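/- Fix an integer n ≥ 1. There exist constants 0 < cₙ ≤ Cₙ and a₀ ∈ (0,1) such that for every a ∈ (0, a₀), the n-th eigenvalue of the logarithmic potential operator on the open disc D_a ⊂ ℝ² of radius a centered at the origin satisfies cₙ · a² ≤ λₙ(D_a) ≤ Cₙ · a². -/

import Mathlib

open MeasureTheory Real

noncomputable section

/-- Points of the plane. -/
abbrev Pt2 := EuclideanSpace ℝ (Fin 2)

/-- The logarithmic kernel `-(1/(2π)) log |x - y|` in dimension 2. -/
def logKernel (x y : Pt2) : ℝ := -(1 / (2 * π)) * Real.log (dist x y)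

/-- The logarithmic potential operator `N_Ω`. -/
def NOp (Ω : Set Pt2) (f : Pt2 → ℝ) (x : Pt2) : ℝ := ∫ y in Ω, logKernel x y * f y

/-- The quadratic form `⟨N_Ω u, u⟩` on `L²(Ω)`. -/
def quadForm (Ω : Set Pt2) (u : Lp ℝ 2 (volume.restrict Ω)) : ℝ :=
  ∫ x in Ω, NOp Ω u x * u x

/-- The `n`-th eigenvalue of the logarithmic potential operator, via the max–min principle:
`λ_n(Ω) = sup` over `(n+1)`-dimensional subspaces `Ξ` of `L²(Ω)` of
`inf` over nonzero `u ∈ Ξ` of `⟨N_Ω u, u⟩ / ‖u‖²`. -/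
def eigen2 (Ω : Set Pt2) (n : ℕ) : ℝ :=
  sSup {r : ℝ | ∃ Ξ : Submodule ℝ (Lp ℝ 2 (volume.restrict Ω)),
    Module.finrank ℝ ↥Ξ = n + 1 ∧
    r = sInf {q : ℝ | ∃ u ∈ Ξ, u ≠ 0 ∧ q = quadForm Ω u / ‖u‖ ^ 2}}

/-- The sandwich hypothesis: `Ω` is squeezed between two discs of radii comparable to `a`. -/
def Sandwich (c₁ c₂ a : ℝ) (Ω : Set Pt2) : Prop :=
  ∃ (z₁ z₂ : Pt2) (ρ₁ ρ₂ : ℝ),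
    c₁ * a ≤ ρ₁ ∧ ρ₁ ≤ c₂ * a ∧ c₁ * a ≤ ρ₂ ∧ ρ₂ ≤ c₂ * a ∧
    Metric.ball z₁ ρ₁ ⊆ Ω ∧ Ω ⊆ Metric.ball z₂ ρ₂


namespace DiscScaling

/-- The measure on the disc. -/
abbrev mu (a : ℝ) : Measure Pt2 := volume.restrict (Metric.ball (0 : Pt2) a)

/-- Radial majorant of the normalised logarithmic kernel. -/
def kf (R r : ℝ) : ℝ := if r = 0 then |Real.log R| else if r < R then R / r else 0

/-- Normalised logarithmic kernel. -/
def ell (a : ℝ) (x y : Pt2) : ℝ := Real.log (2 * a) - Real.log (dist x y)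

lemma kf_nonneg {R : ℝ} (hR : 0 < R) {r : ℝ} (hr : 0 ≤ r) : 0 ≤ kf R r := by
  unfold kf
  split_ifs <;> positivity

lemma kf_weight {R : ℝ} {y : ℝ} (hy : y ∈ Set.Ioi (0 : ℝ)) :
    y ^ (Module.finrank ℝ Pt2 - 1) • kf R y = (Set.Iio R).indicator (fun _ => R) y := by
  have hy' : 0 < y := hy
  simp only [finrank_euclideanSpace, Fintype.card_fin, kf, hy'.ne', if_false, Set.indicator,
    Set.mem_Iio, smul_eq_mul]
  split_ifs
  · norm_num
    field_simp
  · simp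

lemma kf_integrable {R : ℝ} : Integrable (fun z : Pt2 => kf R ‖z‖) := by
  rw [integrable_fun_norm_addHaar (volume : Measure Pt2) (f := kf R)]
  rw [integrableOn_congr_fun (fun y hy => kf_weight hy) measurableSet_Ioi]
  rw [IntegrableOn, integrable_indicator_iff measurableSet_Iio, IntegrableOn,
    Measure.restrict_restrict measurableSet_Iio]
  refine integrableOn_const ?_
  rw [Set.inter_comm, Set.Ioi_inter_Iio]
  simp

lemma real_ball (x : Pt2) {r : ℝ} (hr : 0 ≤ r) : volume.real (Metric.ball x r) = π * r ^ 2 := by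
  rw [measureReal_def, EuclideanSpace.volume_ball_fin_two]
  rw [ENNReal.toReal_mul, ENNReal.toReal_pow, ENNReal.toReal_ofReal hr,
    ENNReal.toReal_ofReal pi_pos.le]
  ring

lemma kf_integral {R : ℝ} (hR : 0 < R) : ∫ z : Pt2, kf R ‖z‖ = 2 * π * R ^ 2 := by
  rw [integral_fun_norm_addHaar (volume : Measure Pt2) (f := kf R)]
  rw [setIntegral_congr_fun measurableSet_Ioi (fun y hy => kf_weight hy)]
  rw [integral_indicator measurableSet_Iio, Measure.restrict_restrict measurableSet_Iio,
    Set.inter_comm, Set.Ioi_inter_Iio, setIntegral_const, real_ball _ zero_le_one]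
  simp [hR.le]
  ring

lemma ell_bound {a : ℝ} {x y : Pt2} (hx : x ∈ Metric.ball (0 : Pt2) a)
    (hy : y ∈ Metric.ball (0 : Pt2) a) : |ell a x y| ≤ kf (2 * a) ‖x - y‖ := by
  have hlt : dist x y < 2 * a := by
    have := dist_triangle_right x y 0
    rw [Metric.mem_ball] at hx hy
    linarith
  unfold ell kf
  rw [← dist_eq_norm]
  split_ifs with h0
  · rw [h0]; simp
  · have hpos : 0 < dist x y := lt_of_le_of_ne dist_nonneg (Ne.symm h0)
    rw [← Real.log_div (by linarith) h0]
    have h1 : 1 ≤ 2 * a / dist x y := by rw [le_div_iff₀ hpos]; linarith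
    rw [abs_of_nonneg (Real.log_nonneg h1)]
    exact Real.log_le_self (by linarith)

lemma ell_meas (a : ℝ) : Measurable (fun p : Pt2 × Pt2 => ell a p.1 p.2) := by
  unfold ell
  fun_prop

lemma ae_mem (a : ℝ) : ∀ᵐ p ∂((mu a).prod (mu a)),
    p.1 ∈ Metric.ball (0 : Pt2) a ∧ p.2 ∈ Metric.ball (0 : Pt2) a := by
  rw [mu, Measure.prod_restrict]
  filter_upwards [ae_restrict_mem (Metric.isOpen_ball.measurableSet.prod
    Metric.isOpen_ball.measurableSet)] with p hp
  exact hp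

lemma conv_int {a : ℝ} {v : Pt2 → ℝ} (hv : MemLp v 2 (mu a)) :
    Integrable (fun p : Pt2 × Pt2 => v p.2 ^ 2 * kf (2 * a) ‖p.1 - p.2‖)
      ((volume : Measure Pt2).prod (mu a)) :=
  hv.integrable_sq.convolution_integrand (ContinuousLinearMap.mul ℝ ℝ) kf_integrable

lemma prod_le (a : ℝ) : (mu a).prod (mu a) ≤ (volume : Measure Pt2).prod (mu a) :=
  Measure.prod_mono Measure.restrict_le_self le_rfl

lemma right_int {a : ℝ} {v : Pt2 → ℝ} (hv : MemLp v 2 (mu a)) :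
    Integrable (fun p : Pt2 × Pt2 => v p.2 ^ 2 * kf (2 * a) ‖p.1 - p.2‖)
      ((mu a).prod (mu a)) :=
  (conv_int hv).mono_measure (prod_le a)

lemma right_le {a : ℝ} (ha : 0 < a) {v : Pt2 → ℝ} (hv : MemLp v 2 (mu a)) :
    ∫ p : Pt2 × Pt2, v p.2 ^ 2 * kf (2 * a) ‖p.1 - p.2‖ ∂((mu a).prod (mu a))
      ≤ 8 * π * a ^ 2 * ∫ x, v x ^ 2 ∂(mu a) := by
  refine (integral_mono_measure (prod_le a) (Filter.Eventually.of_forall fun p =>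
    mul_nonneg (sq_nonneg _) (kf_nonneg (by linarith) (norm_nonneg _))) (conv_int hv)).trans ?_
  rw [integral_prod _ (conv_int hv)]
  have := integral_convolution (μ := (volume : Measure Pt2)) (ContinuousLinearMap.mul ℝ ℝ)
    hv.integrable_sq (kf_integrable (R := 2 * a))
  simp only [convolution, ContinuousLinearMap.mul_apply'] at this
  rw [this, kf_integral (by linarith)]
  apply le_of_eq
  ring

lemma left_int {a : ℝ} {v : Pt2 → ℝ} (hv : MemLp v 2 (mu a)) :
    Integrable (fun p : Pt2 × Pt2 => v p.1 ^ 2 * kf (2 * a) ‖p.1 - p.2‖)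
      ((mu a).prod (mu a)) := by
  have := (right_int hv).swap
  refine this.congr (Filter.Eventually.of_forall fun p => ?_)
  simp [norm_sub_rev]

lemma left_le {a : ℝ} (ha : 0 < a) {v : Pt2 → ℝ} (hv : MemLp v 2 (mu a)) :
    ∫ p : Pt2 × Pt2, v p.1 ^ 2 * kf (2 * a) ‖p.1 - p.2‖ ∂((mu a).prod (mu a))
      ≤ 8 * π * a ^ 2 * ∫ x, v x ^ 2 ∂(mu a) := by
  refine le_trans (le_of_eq ?_) (right_le ha hv)
  rw [← integral_prod_swap]
  refine integral_congr_ae (Filter.Eventually.of_forall fun p => ?_)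
  simp [norm_sub_rev]

lemma pt_bound {a : ℝ} (u v : Pt2 → ℝ) : ∀ᵐ p ∂((mu a).prod (mu a)),
    ‖ell a p.1 p.2 * u p.1 * v p.2‖ ≤ (1 / 2) * (u p.1 ^ 2 * kf (2 * a) ‖p.1 - p.2‖)
      + (1 / 2) * (v p.2 ^ 2 * kf (2 * a) ‖p.1 - p.2‖) := by
  filter_upwards [ae_mem a] with p hp
  have h := ell_bound hp.1 hp.2
  rw [Real.norm_eq_abs, mul_assoc, abs_mul]
  have h2 : |u p.1 * v p.2| ≤ (u p.1 ^ 2 + v p.2 ^ 2) / 2 := by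
    rw [abs_le]
    constructor <;> nlinarith [sq_nonneg (u p.1 + v p.2), sq_nonneg (u p.1 - v p.2)]
  have := mul_le_mul h h2 (abs_nonneg _) ((abs_nonneg _).trans h)
  linarith

lemma ell_int {a : ℝ} {u v : Pt2 → ℝ} (hu : MemLp u 2 (mu a)) (hv : MemLp v 2 (mu a)) :
    Integrable (fun p : Pt2 × Pt2 => ell a p.1 p.2 * u p.1 * v p.2) ((mu a).prod (mu a)) := by
  refine Integrable.mono' (((left_int hu).const_mul (1 / 2)).add ((right_int hv).const_mul (1 / 2)))
    ?_ (pt_bound u v)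
  exact ((ell_meas a).aestronglyMeasurable.mul hu.1.comp_fst).mul hv.1.comp_snd

lemma ell_le {a : ℝ} (ha : 0 < a) {u : Pt2 → ℝ} (hu : MemLp u 2 (mu a)) :
    |∫ p : Pt2 × Pt2, ell a p.1 p.2 * u p.1 * u p.2 ∂((mu a).prod (mu a))|
      ≤ 8 * π * a ^ 2 * ∫ x, u x ^ 2 ∂(mu a) := by
  rw [← Real.norm_eq_abs]
  refine (norm_integral_le_of_norm_le
    (((left_int hu).const_mul (1 / 2)).add ((right_int hu).const_mul (1 / 2)))
    (pt_bound u u)).trans ?_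
  simp only [Pi.add_apply]
  rw [integral_add ((left_int hu).const_mul (1 / 2)) ((right_int hu).const_mul (1 / 2)),
    integral_const_mul, integral_const_mul]
  linarith [left_le ha hu, right_le ha hu]

lemma finite_mu (a : ℝ) : IsFiniteMeasure (mu a) :=
  ⟨by rw [mu, Measure.restrict_apply_univ]; exact measure_ball_lt_top⟩

lemma quad_eq {a : ℝ} (u : Lp ℝ 2 (mu a)) :
    quadForm (Metric.ball (0 : Pt2) a) u = 1 / (2 * π) * (-Real.log (2 * a) * (∫ x, u x ∂(mu a)) ^ 2
      + ∫ p : Pt2 × Pt2, ell a p.1 p.2 * u p.1 * u p.2 ∂((mu a).prod (mu a))) := by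
  have hu := Lp.memLp u
  have := finite_mu a
  have hui : Integrable u (mu a) := hu.integrable (by norm_num)
  have h1 := (hui.mul_prod hui).const_mul (-Real.log (2 * a))
  have h2 := ell_int hu hu
  have h3 : Integrable (fun p : Pt2 × Pt2 => 1 / (2 * π) * (-Real.log (2 * a) * (u p.1 * u p.2)
      + ell a p.1 p.2 * u p.1 * u p.2)) ((mu a).prod (mu a)) := (h1.add h2).const_mul (1 / (2 * π))
  have e1 : ∫ p : Pt2 × Pt2, u p.1 * u p.2 ∂((mu a).prod (mu a)) = (∫ x, u x ∂(mu a)) ^ 2 := by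
    rw [integral_prod_mul, sq]
  rw [← e1, ← integral_const_mul, ← integral_add h1 h2, ← integral_const_mul]
  rw [integral_prod _ h3]
  unfold quadForm NOp
  refine integral_congr_ae (Filter.Eventually.of_forall fun x => ?_)
  simp only
  rw [← integral_mul_const]
  refine integral_congr_ae (Filter.Eventually.of_forall fun y => ?_)
  simp only [logKernel, ell]
  ring

lemma norm_sq_eq {a : ℝ} (u : Lp ℝ 2 (mu a)) : ‖u‖ ^ 2 = ∫ x, u x ^ 2 ∂(mu a) := by
  rw [← real_inner_self_eq_norm_sq, L2.inner_def]
  refine integral_congr_ae (Filter.Eventually.of_forall fun y => ?_)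
  simp [sq]

lemma quad_lower {a : ℝ} (ha : 0 < a) (ha2 : a < 1 / 2) (u : Lp ℝ 2 (mu a)) :
    -(4 * a ^ 2) * ‖u‖ ^ 2 ≤ quadForm (Metric.ball (0 : Pt2) a) u := by
  rw [quad_eq, norm_sq_eq]
  have h := (abs_le.mp (ell_le ha (Lp.memLp u))).1
  have hl : 0 ≤ -Real.log (2 * a) := by
    have := Real.log_nonpos (by linarith : 0 ≤ 2 * a) (by linarith); linarith
  have h1 := mul_nonneg hl (sq_nonneg (∫ x, u x ∂(mu a)))
  have hp := pi_pos
  rw [one_div, ← div_eq_inv_mul, le_div_iff₀ (by positivity)]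
  linarith

lemma quad_upper {a : ℝ} (ha : 0 < a) (u : Lp ℝ 2 (mu a)) (h0 : ∫ x, u x ∂(mu a) = 0) :
    quadForm (Metric.ball (0 : Pt2) a) u ≤ 4 * a ^ 2 * ‖u‖ ^ 2 := by
  rw [quad_eq, norm_sq_eq, h0]
  have h := (abs_le.mp (ell_le ha (Lp.memLp u))).2
  have hp := pi_pos
  rw [one_div, ← div_eq_inv_mul, div_le_iff₀ (by positivity)]
  linarith

lemma bddBelow {a : ℝ} (ha : 0 < a) (ha2 : a < 1 / 2) (Ξ : Submodule ℝ (Lp ℝ 2 (mu a))) :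
    BddBelow {q : ℝ | ∃ u ∈ Ξ, u ≠ 0 ∧ q = quadForm (Metric.ball (0 : Pt2) a) u / ‖u‖ ^ 2} := by
  refine ⟨-(4 * a ^ 2), ?_⟩
  rintro q ⟨u, -, hu, rfl⟩
  have : 0 < ‖u‖ := norm_pos_iff.mpr hu
  rw [le_div_iff₀ (by positivity)]
  exact quad_lower ha ha2 u

lemma exists_mean_zero {a : ℝ} {n : ℕ} (hn : 1 ≤ n) (Ξ : Submodule ℝ (Lp ℝ 2 (mu a)))
    (h : Module.finrank ℝ ↥Ξ = n + 1) : ∃ u ∈ Ξ, u ≠ 0 ∧ ∫ x, u x ∂(mu a) = 0 := by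
  have := finite_mu a
  have hi : ∀ u : Lp ℝ 2 (mu a), Integrable u (mu a) := fun u =>
    (Lp.memLp u).integrable (by norm_num)
  let T : ↥Ξ →ₗ[ℝ] ℝ :=
    { toFun := fun u => ∫ x, (u : Lp ℝ 2 (mu a)) x ∂(mu a)
      map_add' := fun u v => by
        rw [← integral_add (hi _) (hi _)]
        exact integral_congr_ae (Lp.coeFn_add (u : Lp ℝ 2 (mu a)) v)
      map_smul' := fun c u => by
        rw [RingHom.id_apply, smul_eq_mul, ← integral_const_mul]
        exact integral_congr_ae (Lp.coeFn_smul c (u : Lp ℝ 2 (mu a))) }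
  have : FiniteDimensional ℝ ↥Ξ := Module.finite_of_finrank_pos (by omega)
  have hk : LinearMap.ker T ≠ ⊥ := T.ker_ne_bot_of_finrank_lt (by rw [h, Module.finrank_self]; omega)
  obtain ⟨u, hu, hu0⟩ := (Submodule.ne_bot_iff _).mp hk
  exact ⟨u, u.2, by simpa using hu0, hu⟩

lemma le_upper {a : ℝ} (ha : 0 < a) (ha2 : a < 1 / 2) {n : ℕ} (hn : 1 ≤ n) (r : ℝ)
    (hr : ∃ Ξ : Submodule ℝ (Lp ℝ 2 (mu a)), Module.finrank ℝ ↥Ξ = n + 1 ∧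
      r = sInf {q : ℝ | ∃ u ∈ Ξ, u ≠ 0 ∧ q = quadForm (Metric.ball (0 : Pt2) a) u / ‖u‖ ^ 2}) :
    r ≤ 4 * a ^ 2 := by
  obtain ⟨Ξ, h, rfl⟩ := hr
  obtain ⟨u, hu, hu0, hm⟩ := exists_mean_zero hn Ξ h
  refine (csInf_le (bddBelow ha ha2 Ξ) ⟨u, hu, hu0, rfl⟩).trans ?_
  have : 0 < ‖u‖ := norm_pos_iff.mpr hu0
  rw [div_le_iff₀ (by positivity)]
  exact quad_upper ha u hm

/-- Centres of the small discs. -/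
def ctr (n : ℕ) (a : ℝ) (i : Fin (n + 1)) : Pt2 :=
  EuclideanSpace.single 0 (a * ((i : ℕ) : ℝ) / ((n : ℝ) + 1))

/-- Bound on the off-diagonal interaction. -/
def MM (n : ℕ) : ℝ := Real.log (4 * ((n : ℝ) + 1))

/-- Relative radius of the small discs. -/
def eps (n : ℕ) : ℝ := Real.exp (-(((n : ℝ) + 1) * MM n + 1))

/-- The small discs. -/
def BB (n : ℕ) (a : ℝ) (i : Fin (n + 1)) : Set Pt2 := Metric.ball (ctr n a i) (a * eps n)

lemma MM_pos (n : ℕ) : 0 < MM n := by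
  apply Real.log_pos
  have : (0 : ℝ) ≤ n := Nat.cast_nonneg n
  linarith

lemma eps_pos (n : ℕ) : 0 < eps n := Real.exp_pos _

lemma eps_le (n : ℕ) : eps n ≤ 1 / (4 * ((n : ℝ) + 1)) := by
  have hn : (0 : ℝ) ≤ n := Nat.cast_nonneg n
  have hM := MM_pos n
  have h : eps n ≤ Real.exp (-MM n) := by
    apply Real.exp_le_exp.mpr
    nlinarith [mul_nonneg hn hM.le]
  rw [Real.exp_neg, MM, Real.exp_log (by linarith)] at h
  simpa using h

lemma BB_sub {n : ℕ} {a : ℝ} (ha : 0 < a) (i : Fin (n + 1)) :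
    BB n a i ⊆ Metric.ball (0 : Pt2) a := by
  apply Metric.ball_subset_ball'
  have hn : (0 : ℝ) ≤ n := Nat.cast_nonneg n
  have hi : ((i : ℕ) : ℝ) ≤ n := by exact_mod_cast Nat.lt_succ_iff.mp i.2
  rw [dist_zero_right, ctr, EuclideanSpace.norm_single, Real.norm_eq_abs,
    abs_of_nonneg (by positivity)]
  have h1 := mul_le_mul_of_nonneg_left (eps_le n) ha.le
  have h2 : a * ((i : ℕ) : ℝ) / ((n : ℝ) + 1) ≤ a * n / (n + 1) := by gcongr
  have h3 : a * (1 / (4 * ((n : ℝ) + 1))) + a * n / (n + 1) ≤ a := by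
    have : a * (1 / (4 * ((n : ℝ) + 1))) + a * n / (n + 1) = a * ((1 / 4 + n) / (n + 1)) := by
      field_simp
    rw [this]
    have h4 : (1 / 4 + (n : ℝ)) / (n + 1) ≤ 1 := by
      rw [div_le_one (by positivity)]; linarith
    nlinarith
  linarith

lemma ctr_dist {n : ℕ} {a : ℝ} (ha : 0 < a) {i j : Fin (n + 1)} (hij : i ≠ j) :
    a / ((n : ℝ) + 1) ≤ dist (ctr n a i) (ctr n a j) := by
  have hn : (0 : ℝ) ≤ n := Nat.cast_nonneg n
  rw [ctr, ctr, EuclideanSpace.dist_single_same, Real.dist_eq]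
  have h1 : (1 : ℝ) ≤ |((i : ℕ) : ℝ) - ((j : ℕ) : ℝ)| := by
    have h : (1 : ℤ) ≤ |((i : ℕ) : ℤ) - ((j : ℕ) : ℤ)| := by
      apply Int.one_le_abs
      intro h
      apply hij
      ext
      omega
    exact_mod_cast h
  have : a * ((i : ℕ) : ℝ) / ((n : ℝ) + 1) - a * ((j : ℕ) : ℝ) / ((n : ℝ) + 1)
      = a / (n + 1) * (((i : ℕ) : ℝ) - ((j : ℕ) : ℝ)) := by ring
  rw [this, abs_mul, abs_of_nonneg (by positivity)]
  exact le_mul_of_one_le_right (by positivity) h1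

lemma ell_off {n : ℕ} {a : ℝ} (ha : 0 < a) {i j : Fin (n + 1)} (hij : i ≠ j) {x y : Pt2}
    (hx : x ∈ BB n a i) (hy : y ∈ BB n a j) : 0 ≤ ell a x y ∧ ell a x y ≤ MM n := by
  have hn : (0 : ℝ) ≤ n := Nat.cast_nonneg n
  have hx' := BB_sub ha i hx
  have hy' := BB_sub ha j hy
  have hlt : dist x y < 2 * a := by
    have := dist_triangle_right x y 0
    rw [Metric.mem_ball] at hx' hy'
    linarith
  have h1 := mul_le_mul_of_nonneg_left (eps_le n) ha.le
  have hd : a / (2 * ((n : ℝ) + 1)) ≤ dist x y := by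
    have h2 := ctr_dist ha hij
    have h3 := dist_triangle4 (ctr n a i) x y (ctr n a j)
    rw [BB, Metric.mem_ball] at hx hy
    rw [dist_comm (ctr n a i) x] at h3
    have h4 : a * (1 / (4 * ((n : ℝ) + 1))) = a / ((n : ℝ) + 1) / 4 := by field_simp
    have h5 : a / (2 * ((n : ℝ) + 1)) = a / ((n : ℝ) + 1) / 2 := by field_simp
    linarith
  have hpos : 0 < a / (2 * ((n : ℝ) + 1)) := by positivity
  have hdpos : 0 < dist x y := hpos.trans_le hd
  unfold ell
  constructor
  · have := Real.log_le_log hdpos hlt.le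
    linarith
  · have h6 := Real.log_le_log hpos hd
    have h7 : Real.log (2 * a) = Real.log (4 * ((n : ℝ) + 1)) + Real.log (a / (2 * ((n : ℝ) + 1))) := by
      rw [← Real.log_mul (by positivity) hpos.ne']
      congr 1
      field_simp
      ring
    rw [MM]
    linarith

lemma ell_diag {n : ℕ} {a : ℝ} (ha : 0 < a) {i : Fin (n + 1)} {x y : Pt2}
    (hx : x ∈ BB n a i) (hy : y ∈ BB n a i) (hxy : x ≠ y) :
    ((n : ℝ) + 1) * MM n + 1 ≤ ell a x y := by
  have hd : dist x y ≤ 2 * a * eps n := by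
    have := dist_triangle_right x y (ctr n a i)
    rw [BB, Metric.mem_ball] at hx hy
    linarith
  have h := Real.log_le_log (dist_pos.mpr hxy) hd
  rw [Real.log_mul (by positivity) (eps_pos n).ne', eps, Real.log_exp] at h
  unfold ell
  linarith

lemma ae_ne (a : ℝ) : ∀ᵐ p ∂((mu a).prod (mu a)), p.1 ≠ p.2 := by
  rw [ae_iff]
  have hm : MeasurableSet {p : Pt2 × Pt2 | ¬ p.1 ≠ p.2} := by
    simpa using measurableSet_eq_fun measurable_fst measurable_snd
  rw [Measure.measure_prod_null hm]
  refine Filter.Eventually.of_forall fun x => ?_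
  have : Prod.mk x ⁻¹' {p : Pt2 × Pt2 | ¬ p.1 ≠ p.2} = {x} := by
    ext y; simp [eq_comm]
  simp only [this]
  simp

/-- Indicator of a small disc. -/
def ind (n : ℕ) (a : ℝ) (i : Fin (n + 1)) : Pt2 → ℝ := (BB n a i).indicator (fun _ => 1)

lemma BB_meas (n : ℕ) (a : ℝ) (i : Fin (n + 1)) : MeasurableSet (BB n a i) :=
  Metric.isOpen_ball.measurableSet

lemma mu_BB {n : ℕ} {a : ℝ} (ha : 0 < a) (i : Fin (n + 1)) :
    (mu a).real (BB n a i) = π * (a * eps n) ^ 2 := by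
  rw [mu, measureReal_restrict_apply (BB_meas n a i), Set.inter_eq_left.mpr (BB_sub ha i), BB,
    real_ball _ (mul_pos ha (eps_pos n)).le]

lemma mu_BB_ne (n : ℕ) (a : ℝ) (i : Fin (n + 1)) : (mu a) (BB n a i) ≠ ⊤ := by
  have := finite_mu a
  exact measure_ne_top _ _

lemma ind_memLp (n : ℕ) (a : ℝ) (i : Fin (n + 1)) : MemLp (ind n a i) 2 (mu a) :=
  memLp_indicator_const 2 (BB_meas n a i) 1 (Or.inr (mu_BB_ne n a i))

lemma ind_integral {n : ℕ} {a : ℝ} (ha : 0 < a) (i : Fin (n + 1)) :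
    ∫ x, ind n a i x ∂(mu a) = π * (a * eps n) ^ 2 := by
  unfold ind
  rw [integral_indicator_const _ (BB_meas n a i), mu_BB ha]
  simp

lemma ind_prod_int (n : ℕ) (a : ℝ) (i j : Fin (n + 1)) :
    Integrable (fun p : Pt2 × Pt2 => ind n a i p.1 * ind n a j p.2) ((mu a).prod (mu a)) := by
  have := finite_mu a
  exact ((ind_memLp n a i).integrable (by norm_num)).mul_prod
    ((ind_memLp n a j).integrable (by norm_num))

/-- Interaction of two small discs. -/
def ee (n : ℕ) (a : ℝ) (i j : Fin (n + 1)) : ℝ :=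
  ∫ p : Pt2 × Pt2, ell a p.1 p.2 * ind n a i p.1 * ind n a j p.2 ∂((mu a).prod (mu a))

lemma ee_diag {n : ℕ} {a : ℝ} (ha : 0 < a) (i : Fin (n + 1)) :
    (((n : ℝ) + 1) * MM n + 1) * (π * (a * eps n) ^ 2) ^ 2 ≤ ee n a i i := by
  have h : ∫ p : Pt2 × Pt2, (((n : ℝ) + 1) * MM n + 1) * (ind n a i p.1 * ind n a i p.2)
      ∂((mu a).prod (mu a)) = (((n : ℝ) + 1) * MM n + 1) * (π * (a * eps n) ^ 2) ^ 2 := by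
    rw [integral_const_mul, integral_prod_mul, ind_integral ha]
    ring
  rw [← h, ee]
  refine integral_mono_ae ((ind_prod_int n a i i).const_mul _)
    (ell_int (ind_memLp n a i) (ind_memLp n a i)) ?_
  filter_upwards [ae_ne a] with p hp
  rw [mul_assoc (ell a p.1 p.2)]
  by_cases h1 : p.1 ∈ BB n a i
  · by_cases h2 : p.2 ∈ BB n a i
    · simpa [ind, h1, h2] using ell_diag ha h1 h2 hp
    · simp [ind, h2]
  · simp [ind, h1]

lemma ee_off {n : ℕ} {a : ℝ} (ha : 0 < a) {i j : Fin (n + 1)} (hij : i ≠ j) :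
    0 ≤ ee n a i j ∧ ee n a i j ≤ MM n * (π * (a * eps n) ^ 2) ^ 2 := by
  constructor
  · refine integral_nonneg fun p => ?_
    rw [mul_assoc (ell a p.1 p.2)]
    by_cases h1 : p.1 ∈ BB n a i
    · by_cases h2 : p.2 ∈ BB n a j
      · simpa [ind, h1, h2] using (ell_off ha hij h1 h2).1
      · simp [ind, h2]
    · simp [ind, h1]
  · have h : ∫ p : Pt2 × Pt2, MM n * (ind n a i p.1 * ind n a j p.2)
        ∂((mu a).prod (mu a)) = MM n * (π * (a * eps n) ^ 2) ^ 2 := by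
      rw [integral_const_mul, integral_prod_mul, ind_integral ha, ind_integral ha]
      ring
    rw [← h, ee]
    refine integral_mono (ell_int (ind_memLp n a i) (ind_memLp n a j))
      ((ind_prod_int n a i j).const_mul _) fun p => ?_
    simp only [mul_assoc (ell a p.1 p.2)]
    by_cases h1 : p.1 ∈ BB n a i
    · by_cases h2 : p.2 ∈ BB n a j
      · simpa [ind, h1, h2] using (ell_off ha hij h1 h2).2
      · simp [ind, h2]
    · simp [ind, h1]

lemma term_bound {m L M x y e : ℝ} (hM : 0 ≤ M) (he0 : 0 ≤ e) (he : e ≤ M * m ^ 2) :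
    -(M * m ^ 2 * ((x ^ 2 + y ^ 2) / 2)) ≤ x * y * e := by
  have h1 : -((x ^ 2 + y ^ 2) / 2) ≤ x * y := by nlinarith [sq_nonneg (x + y)]
  have h2 := mul_le_mul_of_nonneg_right h1 he0
  have h3 : 0 ≤ (x ^ 2 + y ^ 2) / 2 := by positivity
  have h4 := mul_le_mul_of_nonneg_left he h3
  linarith

lemma sum_bound {n : ℕ} {a : ℝ} (ha : 0 < a) (c : Fin (n + 1) → ℝ) :
    (π * (a * eps n) ^ 2) ^ 2 * ∑ i, c i ^ 2 ≤ ∑ i, ∑ j, c i * c j * ee n a i j := by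
  set m := π * (a * eps n) ^ 2 with hm
  have hM := (MM_pos n).le
  have key : ∀ i j, (if i = j then (((n : ℝ) + 1) * MM n + 1) * m ^ 2 * c i ^ 2 else 0)
      - (MM n * m ^ 2 * ((c i ^ 2 + c j ^ 2) / 2)) ≤ c i * c j * ee n a i j := by
    intro i j
    split_ifs with h
    · subst h
      have h1 := mul_le_mul_of_nonneg_left (ee_diag ha i) (sq_nonneg (c i))
      have h2 : 0 ≤ MM n * m ^ 2 * ((c i ^ 2 + c i ^ 2) / 2) := by positivity
      rw [← hm] at h1
      linarith
    · have h1 := ee_off ha h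
      rw [← hm] at h1
      have := term_bound (L := 0) (x := c i) (y := c j) hM h1.1 h1.2
      linarith
  refine le_trans (le_of_eq ?_) (Finset.sum_le_sum fun i _ => Finset.sum_le_sum fun j _ => key i j)
  simp only [Finset.sum_sub_distrib, Finset.sum_ite_eq, Finset.mem_univ, if_true,
    ← Finset.mul_sum, ← Finset.sum_div, Finset.sum_add_distrib, Finset.sum_const, Finset.card_univ,
    Fintype.card_fin, nsmul_eq_mul]
  push_cast
  ring

/-- The small-disc indicator in `L²`. -/
def fL (n : ℕ) (a : ℝ) (i : Fin (n + 1)) : Lp ℝ 2 (mu a) :=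
  indicatorConstLp 2 (BB_meas n a i) (mu_BB_ne n a i) (1 : ℝ)

lemma comb_ae {n : ℕ} {a : ℝ} (c : Fin (n + 1) → ℝ) :
    (∑ i, c i • fL n a i : Lp ℝ 2 (mu a)) =ᵐ[mu a] fun x => ∑ i, c i * ind n a i x := by
  have h1 : ∀ᵐ x ∂(mu a), ∀ i, (c i • fL n a i : Lp ℝ 2 (mu a)) x = c i * ind n a i x := by
    rw [ae_all_iff]
    intro i
    filter_upwards [Lp.coeFn_smul (c i) (fL n a i),
      indicatorConstLp_coeFn (p := 2) (hs := BB_meas n a i) (hμs := mu_BB_ne n a i) (c := (1 : ℝ))]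
      with x hx hx2
    rw [hx, Pi.smul_apply, smul_eq_mul, fL, hx2, ind]
  have h2 : ((∑ i, c i • fL n a i : Lp ℝ 2 (mu a)) : Pt2 → ℝ) =ᵐ[mu a]
      fun x => ∑ i, (c i • fL n a i : Lp ℝ 2 (mu a)) x := by
    have := Lp.coeFn_finsetSum Finset.univ (fun i => c i • fL n a i)
    filter_upwards [this] with x hx
    rw [hx]
    simp
  filter_upwards [h1, h2] with x hx1 hx2
  rw [hx2]
  exact Finset.sum_congr rfl fun i _ => hx1 i

lemma comb_quad {n : ℕ} {a : ℝ} (ha : 0 < a) (ha2 : a < 1 / 2) (c : Fin (n + 1) → ℝ) :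
    1 / (2 * π) * ((π * (a * eps n) ^ 2) ^ 2 * ∑ i, c i ^ 2) ≤
      quadForm (Metric.ball (0 : Pt2) a) (∑ i, c i • fL n a i : Lp ℝ 2 (mu a)) := by
  have := finite_mu a
  rw [quad_eq]
  have hl : 0 ≤ -Real.log (2 * a) := by
    have := Real.log_nonpos (by linarith : 0 ≤ 2 * a) (by linarith); linarith
  have h1 := mul_nonneg hl (sq_nonneg (∫ x, (∑ i, c i • fL n a i : Lp ℝ 2 (mu a)) x ∂(mu a)))
  have h2 : ∫ p : Pt2 × Pt2, ell a p.1 p.2 * (∑ i, c i • fL n a i : Lp ℝ 2 (mu a)) p.1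
      * (∑ i, c i • fL n a i : Lp ℝ 2 (mu a)) p.2 ∂((mu a).prod (mu a))
      = ∑ i, ∑ j, c i * c j * ee n a i j := by
    have e1 : ∀ᵐ p ∂((mu a).prod (mu a)), (∑ i, c i • fL n a i : Lp ℝ 2 (mu a)) p.1 =
        ∑ i, c i * ind n a i p.1 := Measure.quasiMeasurePreserving_fst.ae (comb_ae c)
    have e2 : ∀ᵐ p ∂((mu a).prod (mu a)), (∑ i, c i • fL n a i : Lp ℝ 2 (mu a)) p.2 =
        ∑ i, c i * ind n a i p.2 := Measure.quasiMeasurePreserving_snd.ae (comb_ae c)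
    have e3 : ∀ i j, Integrable (fun p : Pt2 × Pt2 =>
        c i * c j * (ell a p.1 p.2 * ind n a i p.1 * ind n a j p.2)) ((mu a).prod (mu a)) :=
      fun i j => (ell_int (ind_memLp n a i) (ind_memLp n a j)).const_mul _
    simp only [ee, ← integral_const_mul]
    rw [Finset.sum_congr rfl fun i _ => (integral_finsetSum Finset.univ fun j _ => e3 i j).symm,
      ← integral_finsetSum Finset.univ fun i _ => integrable_finsetSum _ fun j _ => e3 i j]
    refine integral_congr_ae ?_
    filter_upwards [e1, e2] with p h1 h2
    rw [h1, h2, mul_assoc, Finset.sum_mul_sum, Finset.mul_sum]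
    refine Finset.sum_congr rfl fun i _ => ?_
    rw [Finset.mul_sum]
    refine Finset.sum_congr rfl fun j _ => ?_
    ring
  rw [h2]
  have h3 := sum_bound ha c
  have hp := pi_pos
  gcongr
  linarith

lemma comb_norm {n : ℕ} {a : ℝ} (ha : 0 < a) (c : Fin (n + 1) → ℝ) :
    ‖(∑ i, c i • fL n a i : Lp ℝ 2 (mu a))‖ ^ 2 ≤
      ((n : ℝ) + 1) * (π * (a * eps n) ^ 2 * ∑ i, c i ^ 2) := by
  have h1 : ‖(∑ i, c i • fL n a i : Lp ℝ 2 (mu a))‖ ≤ ∑ i, ‖c i • fL n a i‖ := norm_sum_le _ _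
  have h2 := pow_le_pow_left₀ (norm_nonneg _) h1 2
  refine h2.trans ((sq_sum_le_card_mul_sum_sq).trans (le_of_eq ?_))
  rw [Finset.card_univ, Fintype.card_fin, Finset.mul_sum Finset.univ (fun i => c i ^ 2)]
  push_cast
  congr 1
  refine Finset.sum_congr rfl fun i _ => ?_
  have h3 : ‖fL n a i‖ ^ 2 = π * (a * eps n) ^ 2 := by
    rw [fL, norm_indicatorConstLp (by norm_num) (by norm_num), mu_BB ha, norm_one, one_mul,
      ← Real.rpow_natCast, ← Real.rpow_mul (by positivity)]
    norm_num
  rw [norm_smul, mul_pow, h3, Real.norm_eq_abs, sq_abs]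
  ring

lemma fL_indep {n : ℕ} {a : ℝ} (ha : 0 < a) (ha2 : a < 1 / 2) :
    LinearIndependent ℝ (fL n a) := by
  rw [Fintype.linearIndependent_iff]
  intro c hc
  have h := comb_quad ha ha2 c
  have h0 : quadForm (Metric.ball (0 : Pt2) a) (0 : Lp ℝ 2 (mu a)) ≤ 0 := by
    have : ‖(0 : Lp ℝ 2 (mu a))‖ = 0 := norm_zero
    have hz := norm_sq_eq (0 : Lp ℝ 2 (mu a))
    rw [this] at hz
    have hi : ∫ x, (0 : Lp ℝ 2 (mu a)) x ∂(mu a) = 0 := by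
      rw [integral_congr_ae (Lp.coeFn_zero ℝ 2 (mu a))]
      simp
    have := quad_upper ha (0 : Lp ℝ 2 (mu a)) hi
    simpa using this
  rw [hc] at h
  have hp := pi_pos
  have he := eps_pos n
  have h1 : 0 < 1 / (2 * π) * (π * (a * eps n) ^ 2) ^ 2 := by positivity
  have h2 : ∑ i, c i ^ 2 ≤ 0 := by
    by_contra hcon
    push Not at hcon
    have := mul_pos h1 hcon
    linarith
  have h3 := (Finset.sum_eq_zero_iff_of_nonneg fun i _ => sq_nonneg (c i)).mp
    (le_antisymm h2 (Finset.sum_nonneg fun i _ => sq_nonneg (c i)))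
  intro i
  exact pow_eq_zero_iff (two_ne_zero) |>.mp (h3 i (Finset.mem_univ i))

lemma lower_ratio {n : ℕ} {a : ℝ} (ha : 0 < a) (ha2 : a < 1 / 2) (u : Lp ℝ 2 (mu a))
    (hu : u ∈ Submodule.span ℝ (Set.range (fL n a))) (hu0 : u ≠ 0) :
    eps n ^ 2 / (2 * ((n : ℝ) + 1)) * a ^ 2 ≤
      quadForm (Metric.ball (0 : Pt2) a) u / ‖u‖ ^ 2 := by
  obtain ⟨c, rfl⟩ := (Submodule.mem_span_range_iff_exists_fun ℝ).mp hu
  have hp := pi_pos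
  have hpos := norm_pos_iff.mpr hu0
  rw [le_div_iff₀ (by positivity)]
  refine le_trans ?_ (comb_quad ha ha2 c)
  refine (mul_le_mul_of_nonneg_left (comb_norm ha c) (by positivity)).trans (le_of_eq ?_)
  have hn : (0 : ℝ) < (n : ℝ) + 1 := by positivity
  field_simp

end DiscScaling

/-- For `n ≥ 1`, the `n`-th eigenvalue of the logarithmic potential operator on the disc of
radius `a` centered at the origin is comparable to `a²`. -/
theorem eigen2_higher_disc_scaling (n : ℕ) (hn : 1 ≤ n) :
    ∃ (cₙ Cₙ a₀ : ℝ), 0 < cₙ ∧ cₙ ≤ Cₙ ∧ 0 < a₀ ∧ a₀ < 1 ∧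
      ∀ a : ℝ, 0 < a → a < a₀ →
        cₙ * a ^ 2 ≤ eigen2 (Metric.ball (0 : Pt2) a) n ∧
          eigen2 (Metric.ball (0 : Pt2) a) n ≤ Cₙ * a ^ 2 := by
  have hn0 : (0 : ℝ) ≤ n := Nat.cast_nonneg n
  have he := DiscScaling.eps_pos n
  have he1 : DiscScaling.eps n ≤ 1 := by
    refine (DiscScaling.eps_le n).trans ?_
    rw [div_le_one (by positivity)]
    linarith
  refine ⟨DiscScaling.eps n ^ 2 / (2 * ((n : ℝ) + 1)), 4, 1 / 2, by positivity, ?_, by norm_num,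
    by norm_num, ?_⟩
  · rw [div_le_iff₀ (by positivity)]
    nlinarith
  · intro a ha ha2
    constructor
    · have hfr : Module.finrank ℝ
          ↥(Submodule.span ℝ (Set.range (DiscScaling.fL n a))) = n + 1 := by
        rw [finrank_span_eq_card (DiscScaling.fL_indep ha ha2), Fintype.card_fin]
      refine le_trans ?_ (le_csSup ⟨4 * a ^ 2, fun r hr => DiscScaling.le_upper ha ha2 hn r hr⟩
        ⟨Submodule.span ℝ (Set.range (DiscScaling.fL n a)), hfr, rfl⟩)
      refine le_csInf ?_ ?_
      · obtain ⟨u, hu, hu0, -⟩ := DiscScaling.exists_mean_zero hn _ hfr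
        exact ⟨_, u, hu, hu0, rfl⟩
      · rintro q ⟨u, hu, hu0, rfl⟩
        exact DiscScaling.lower_ratio ha ha2 u hu hu0
    · exact Real.sSup_le (fun r hr => DiscScaling.le_upper ha ha2 hn r hr) (by positivity)

end
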